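/- Fix r ≥ 0 and nonincreasing (r+1)-tuples ρ ⊇ λ of integers. For nonincreasing (r+1)-tuples ρ' ⊇ λ' define f(ρ',λ') = (−1)^{|ρ'∖λ'|} if no two boxes of ρ'∖λ' are horizontally or vertically adjacent, and f(ρ',λ') = 0 otherwise. Then the sum of f(ρ',λ') over all pairs of nonincreasing (r+1)-tuples (ρ',λ') with ρ ⊇ ρ' ⊇ λ' ⊇ λ equals 1. -/

import Mathlib

namespace Pont

/-- The set of boxes of a nonincreasing `(r+1)`-tuple `l`: all `(x,y)` with `x < l y`. -/
def boxes (r : ℕ) (l : Fin (r + 1) → ℤ) : Set (ℤ × Fin (r + 1)) := {b | b.1 < l b.2}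

end Pont

namespace Pont

variable {r : ℕ}

theorem boxes_subset_iff {p q : Fin (r + 1) → ℤ} : boxes r q ⊆ boxes r p ↔ q ≤ p := by
  constructor
  · intro h y
    have := @h (q y - 1, y) (by simp [boxes])
    simp only [boxes, Set.mem_ofPred_eq] at this
    change q y ≤ p y
    omega
  · intro h b hb
    exact lt_of_lt_of_le hb (h b.2)

/-- No two boxes of the skew shape `p ∖ q` are horizontally or vertically adjacent. -/
def NoAdj (p q : Fin (r + 1) → ℤ) : Prop :=
  ∀ b ∈ boxes r p \ boxes r q,
    (b.1 + 1, b.2) ∉ boxes r p \ boxes r q ∧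
    ∀ y' : Fin (r + 1), (y' : ℕ) = (b.2 : ℕ) + 1 → (b.1, y') ∉ boxes r p \ boxes r q

/-- The rows of `p` whose last box is a removable corner not belonging to `l`. -/
def corners (p l : Fin (r + 1) → ℤ) : Finset (Fin (r + 1)) :=
  {y | l y < p y ∧ ∀ z, y < z → p z < p y}

/-- The tuple `p` with the last box of each row in `S` removed. -/
def removeRows (p : Fin (r + 1) → ℤ) (S : Finset (Fin (r + 1))) : Fin (r + 1) → ℤ :=
  fun y => p y - if y ∈ S then 1 else 0

/-- The rows in which `p` and `q` differ, for `q ≤ p`. -/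
def diffRows (p q : Fin (r + 1) → ℤ) : Finset (Fin (r + 1)) := {y | q y < p y}

theorem diffRows_removeRows (p : Fin (r + 1) → ℤ) (S : Finset (Fin (r + 1))) :
    diffRows p (removeRows p S) = S := by
  ext y
  by_cases hy : y ∈ S <;> simp [diffRows, removeRows, hy]

theorem NoAdj.le_add_one {p q : Fin (r + 1) → ℤ} (h : NoAdj p q) (y : Fin (r + 1)) :
    p y ≤ q y + 1 := by
  by_contra! hy
  have := (h (q y, y) (by simp only [boxes, Set.mem_sdiff, Set.mem_ofPred_eq]; omega)).1
  simp only [boxes, Set.mem_sdiff, Set.mem_ofPred_eq] at this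
  omega

theorem NoAdj.removeRows_diffRows {p q : Fin (r + 1) → ℤ} (h : NoAdj p q) (hqp : q ≤ p) :
    removeRows p (diffRows p q) = q := by
  ext y
  have h1 := h.le_add_one y
  have h2 : q y ≤ p y := hqp y
  by_cases hy : q y < p y <;> simp only [removeRows, diffRows, Finset.mem_filter,
    Finset.mem_univ, true_and, hy, if_true, if_false] <;> omega

theorem NoAdj.diffRows_subset_corners {p q l : Fin (r + 1) → ℤ} (h : NoAdj p q)
    (hp : Antitone p) (hq : Antitone q) (hlq : l ≤ q) : diffRows p q ⊆ corners p l := by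
  intro y hy
  simp only [diffRows, corners, Finset.mem_filter, Finset.mem_univ, true_and] at hy ⊢
  refine ⟨(hlq y).trans_lt hy, fun z hz => ?_⟩
  have hlt : (y : ℕ) + 1 < r + 1 := lt_of_le_of_lt hz z.isLt
  have hyw : y ≤ (⟨y + 1, hlt⟩ : Fin (r + 1)) := Fin.le_def.2 (Nat.le_succ _)
  have hpz : p z ≤ p ⟨y + 1, hlt⟩ := hp (Fin.le_def.2 hz)
  have hqw := hq hyw
  have hadj := (h (q y, y) (by simp only [boxes, Set.mem_sdiff, Set.mem_ofPred_eq]; omega)).2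
    ⟨y + 1, hlt⟩ rfl
  simp only [boxes, Set.mem_sdiff, Set.mem_ofPred_eq] at hadj
  have := h.le_add_one y
  omega

theorem removeRows_le (p : Fin (r + 1) → ℤ) (S : Finset (Fin (r + 1))) :
    removeRows p S ≤ p := by
  intro y
  simp only [removeRows]
  split_ifs <;> omega

theorem le_removeRows {p l : Fin (r + 1) → ℤ} {S : Finset (Fin (r + 1))} (hlp : l ≤ p)
    (hS : S ⊆ corners p l) : l ≤ removeRows p S := by
  intro y
  have h1 : l y ≤ p y := hlp y
  change l y ≤ removeRows p S y
  simp only [removeRows]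
  split_ifs with hy
  · have := (Finset.mem_filter.1 (hS hy)).2.1
    omega
  · omega

theorem antitone_removeRows {p l : Fin (r + 1) → ℤ} {S : Finset (Fin (r + 1))}
    (hp : Antitone p) (hS : S ⊆ corners p l) : Antitone (removeRows p S) := by
  intro y z hyz
  obtain rfl | hlt := hyz.eq_or_lt
  · rfl
  have h1 := hp hyz
  have h2 : y ∈ S → p z < p y := fun hy => (Finset.mem_filter.1 (hS hy)).2.2 z hlt
  simp only [removeRows]
  split_ifs with hz hy hy <;> first | omega | (have := h2 hy; omega)

theorem mem_boxes_diff_removeRows {p : Fin (r + 1) → ℤ} {S : Finset (Fin (r + 1))}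
    {b : ℤ × Fin (r + 1)} :
    b ∈ boxes r p \ boxes r (removeRows p S) ↔ b.2 ∈ S ∧ b.1 = p b.2 - 1 := by
  by_cases hb : b.2 ∈ S <;>
    simp only [boxes, removeRows, Set.mem_sdiff, Set.mem_ofPred_eq, hb, if_true, if_false,
      true_and, false_and, iff_false] <;> omega

theorem noAdj_removeRows {p l : Fin (r + 1) → ℤ} {S : Finset (Fin (r + 1))}
    (hS : S ⊆ corners p l) : NoAdj p (removeRows p S) := by
  intro b hb
  simp only [mem_boxes_diff_removeRows] at hb ⊢
  refine ⟨fun h => by omega, fun y hy h => ?_⟩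
  have := (Finset.mem_filter.1 (hS hb.1)).2.2 y (Fin.lt_def.2 (by omega))
  omega

theorem ncard_boxes_diff_removeRows (p : Fin (r + 1) → ℤ) (S : Finset (Fin (r + 1))) :
    (boxes r p \ boxes r (removeRows p S)).ncard = S.card := by
  have : boxes r p \ boxes r (removeRows p S) = (fun y => (p y - 1, y)) '' (S : Set _) := by
    ext ⟨x, y⟩
    rw [mem_boxes_diff_removeRows]
    simp only [Set.mem_image, Finset.mem_coe, Prod.mk.injEq]
    constructor
    · rintro ⟨hy, rfl⟩
      exact ⟨y, hy, rfl, rfl⟩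
    · rintro ⟨z, hz, rfl, rfl⟩
      exact ⟨hz, rfl⟩
  rw [this, Set.ncard_image_of_injective _ fun y z h => (Prod.ext_iff.1 h).2,
    Set.ncard_coe_finset]

theorem corners_eq_empty_iff {p l : Fin (r + 1) → ℤ} (hl : Antitone l) (hlp : l ≤ p) :
    corners p l = ∅ ↔ p = l := by
  constructor
  · intro h
    by_contra hne
    have hD : (diffRows p l).Nonempty := by
      by_contra hD
      refine hne (le_antisymm (fun y => ?_) hlp)
      by_contra! hy
      exact hD ⟨y, by simpa [diffRows] using hy⟩
    have hmem := Finset.max'_mem _ hD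
    set y := (diffRows p l).max' hD
    have hy : l y < p y := (Finset.mem_filter.1 hmem).2
    refine Finset.notMem_empty y (h ▸ ?_)
    simp only [corners, Finset.mem_filter, Finset.mem_univ, true_and]
    refine ⟨hy, fun z hz => ?_⟩
    have hzl : p z ≤ l z := by
      by_contra! hz'
      exact absurd ((diffRows p l).le_max' z (by simpa [diffRows] using hz')) (not_le.2 hz)
    have := hl hz.le
    omega
  · rintro rfl
    simp [corners]

open Classical in
/-- For fixed `p`, the signed sum over all `q` between `l` and `p` is the Kronecker delta. -/
theorem sum_noAdj {p l : Fin (r + 1) → ℤ} (hp : Antitone p) (hl : Antitone l) (hlp : l ≤ p) :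
    (∑ q ∈ Finset.Icc l p with Antitone q,
      if NoAdj p q then (-1 : ℤ) ^ (boxes r p \ boxes r q).ncard else 0) =
      if p = l then 1 else 0 := by
  rw [← if_congr (corners_eq_empty_iff hl hlp) rfl rfl, ← Finset.sum_powerset_neg_one_pow_card,
    ← Finset.sum_filter]
  refine Finset.sum_nbij' (diffRows p) (removeRows p) ?_ ?_ ?_ ?_ ?_
  · intro q hq
    simp only [Finset.mem_filter, Finset.mem_Icc] at hq
    exact Finset.mem_powerset.2 (hq.2.diffRows_subset_corners hp hq.1.2 hq.1.1.1)
  · intro S hS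
    rw [Finset.mem_powerset] at hS
    simp only [Finset.mem_filter, Finset.mem_Icc]
    exact ⟨⟨⟨le_removeRows hlp hS, removeRows_le p S⟩, antitone_removeRows hp hS⟩,
      noAdj_removeRows hS⟩
  · intro q hq
    simp only [Finset.mem_filter, Finset.mem_Icc] at hq
    exact hq.2.removeRows_diffRows hq.1.1.2
  · intro S _
    exact diffRows_removeRows p S
  · intro q hq
    simp only [Finset.mem_filter, Finset.mem_Icc] at hq
    rw [← ncard_boxes_diff_removeRows p, hq.2.removeRows_diffRows hq.1.1.2]

end Pont

open Classical Pont in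
/-- **Claim (inner sum in Lemma 5.13 of the paper).**  Fix `r ≥ 0` and nonincreasing
`(r+1)`-tuples `ρ ⊇ λ`.  For nonincreasing tuples `ρ' ⊇ λ'` set
`f(ρ',λ') = (−1)^{|ρ'∖λ'|}` if no two boxes of `ρ'∖λ'` are horizontally or vertically
adjacent, and `0` otherwise.  Then `∑_{ρ ⊇ ρ' ⊇ λ' ⊇ λ} f(ρ',λ') = 1`. -/
theorem stmt_4 (r : ℕ) (ρ lam : Fin (r + 1) → ℤ) (hρ : Antitone ρ) (hlam : Antitone lam)
    (h : boxes r lam ⊆ boxes r ρ) :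
    (∑ᶠ p ∈ {p : (Fin (r + 1) → ℤ) × (Fin (r + 1) → ℤ) |
        Antitone p.1 ∧ Antitone p.2 ∧
        boxes r p.1 ⊆ boxes r ρ ∧ boxes r p.2 ⊆ boxes r p.1 ∧ boxes r lam ⊆ boxes r p.2},
      if ∀ b ∈ boxes r p.1 \ boxes r p.2,
            (b.1 + 1, b.2) ∉ boxes r p.1 \ boxes r p.2 ∧
            ∀ y' : Fin (r + 1), (y' : ℕ) = (b.2 : ℕ) + 1 →
              (b.1, y') ∉ boxes r p.1 \ boxes r p.2
      then (-1 : ℤ) ^ (boxes r p.1 \ boxes r p.2).ncard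
      else 0) = 1 := by
  rw [boxes_subset_iff] at h
  have hset : {p : (Fin (r + 1) → ℤ) × (Fin (r + 1) → ℤ) |
        Antitone p.1 ∧ Antitone p.2 ∧
        boxes r p.1 ⊆ boxes r ρ ∧ boxes r p.2 ⊆ boxes r p.1 ∧ boxes r lam ⊆ boxes r p.2} =
      (((Finset.Icc lam ρ ×ˢ Finset.Icc lam ρ).filter fun p =>
        Antitone p.1 ∧ Antitone p.2 ∧ p.2 ≤ p.1 : Finset _) : Set _) := by
    ext p
    simp only [boxes_subset_iff, Set.mem_ofPred_eq, Finset.coe_filter, Finset.mem_product,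
      Finset.mem_Icc]
    constructor
    · rintro ⟨h1, h2, h3, h4, h5⟩
      exact ⟨⟨⟨h5.trans h4, h3⟩, h5, h4.trans h3⟩, h1, h2, h4⟩
    · rintro ⟨⟨⟨_, h3⟩, h5, _⟩, h1, h2, h4⟩
      exact ⟨h1, h2, h3, h4, h5⟩
  rw [hset, finsum_mem_coe_finset, Finset.sum_finset_product _
    ((Finset.Icc lam ρ).filter Antitone) (fun p => (Finset.Icc lam p).filter Antitone)]
  · rw [Finset.sum_congr rfl (g := fun p => if p = lam then (1 : ℤ) else 0)]
    · simp [h, hlam]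
    · intro p hp
      simp only [Finset.mem_filter, Finset.mem_Icc] at hp
      exact sum_noAdj hp.2 hlam hp.1.1
  · intro p
    simp only [Finset.mem_filter, Finset.mem_product, Finset.mem_Icc]
    constructor
    · rintro ⟨⟨⟨h1, h2⟩, h3, _⟩, h4, h5, h6⟩
      exact ⟨⟨⟨h1, h2⟩, h4⟩, ⟨h3, h6⟩, h5⟩
    · rintro ⟨⟨⟨h1, h2⟩, h4⟩, ⟨h3, h6⟩, h5⟩
      exact ⟨⟨⟨h1, h2⟩, h3, h6.trans h2⟩, h4, h5, h6⟩
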